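/- Let p ≥ 1, let D ⊂ ℝⁿ (n ≥ 2) be a domain, and let f: D → ℝⁿ be a continuous, discrete mapping that is differentiable almost everywhere in D and has the N-property, the N⁻¹-property, and the ACP_p⁻¹-property. Suppose Γ is a family of curves in D, m is a positive integer, and f winds every curve of Γ m times around itself. Then for every ρ admissible for Γ, M_p(f(Γ)) ≤ (1/m) · ∫_D K_{I,p}(x,f) · ρ(x)^p dm(x). -/

import Mathlib

open MeasureTheory ENNReal Set

noncomputable section
open scoped Classical

/-- A closed curve in `ℝⁿ`: a continuous map defined on a compact interval `[a, b]`. -/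
structure Curve (n : ℕ) where
  a : ℝ
  b : ℝ
  hab : a ≤ b
  toFun : ℝ → EuclideanSpace ℝ (Fin n)
  cont : ContinuousOn toFun (Set.Icc a b)

namespace Curve

variable {n : ℕ}

/-- The length of a curve, as an extended nonnegative real. -/
def eLength (γ : Curve n) : ℝ≥0∞ := eVariationOn γ.toFun (Set.Icc γ.a γ.b)

/-- A curve is rectifiable if it has finite length. -/
def Rectifiable (γ : Curve n) : Prop := γ.eLength ≠ ⊤

/-- The (real-valued) length of a curve. -/
def length (γ : Curve n) : ℝ := γ.eLength.toReal

/-- The length function `l_γ(t)`: the length of `γ|_[a,t]`. -/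
def lengthFun (γ : Curve n) (t : ℝ) : ℝ := (eVariationOn γ.toFun (Set.Icc γ.a t)).toReal

/-- The normal representation `γ⁰ : [0, l(γ)] → ℝⁿ` of a (rectifiable) curve,
the arclength reparametrization satisfying `γ = γ⁰ ∘ l_γ`. -/
def normalRep (γ : Curve n) (s : ℝ) : EuclideanSpace ℝ (Fin n) :=
  γ.toFun (sInf {t | t ∈ Set.Icc γ.a γ.b ∧ γ.lengthFun t = s})

/-- A curve lies in a set `D`. -/
def InSet (γ : Curve n) (D : Set (EuclideanSpace ℝ (Fin n))) : Prop :=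
  ∀ t ∈ Set.Icc γ.a γ.b, γ.toFun t ∈ D

end Curve

variable {n : ℕ}

/-- The line integral `∫_γ ρ |dx|` of a nonnegative Borel function over a curve,
computed through the normal representation. -/
def lineIntegral (ρ : EuclideanSpace ℝ (Fin n) → ℝ≥0∞) (γ : Curve n) : ℝ≥0∞ :=
  ∫⁻ t in Set.Icc (0 : ℝ) γ.length, ρ (γ.normalRep t)

/-- `ρ` is admissible for the curve family `Γ`: it is Borel and
`∫_γ ρ |dx| ≥ 1` for every (locally) rectifiable curve of the family. -/
def Admissible (ρ : EuclideanSpace ℝ (Fin n) → ℝ≥0∞) (Γ : Set (Curve n)) : Prop :=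
  Measurable ρ ∧ ∀ γ ∈ Γ, γ.Rectifiable → 1 ≤ lineIntegral ρ γ

/-- The `p`-modulus `M_p(Γ)` of a family of curves. -/
def modulus (p : ℝ) (Γ : Set (Curve n)) : ℝ≥0∞ :=
  ⨅ (ρ : EuclideanSpace ℝ (Fin n) → ℝ≥0∞) (_ : Admissible ρ Γ), ∫⁻ x, ρ x ^ p

/-- The image family `f(Γ)`: curves obtained by composing curves of `Γ` with `f`. -/
def pushforward (f : EuclideanSpace ℝ (Fin n) → EuclideanSpace ℝ (Fin n))
    (Γ : Set (Curve n)) : Set (Curve n) :=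
  {β | ∃ γ ∈ Γ, β.a = γ.a ∧ β.b = γ.b ∧ ∀ t ∈ Set.Icc γ.a γ.b, β.toFun t = f (γ.toFun t)}

/-- `l(A) = inf_{|h| = 1} |A h|`. -/
def minNorm (A : EuclideanSpace ℝ (Fin n) →L[ℝ] EuclideanSpace ℝ (Fin n)) : ℝ :=
  sInf ((fun h => ‖A h‖) '' {h | ‖h‖ = 1})

/-- The inner dilatation of order `p` of a linear map `A`:
`|det A| / l(A)^p` if `det A ≠ 0`, `1` if `A = 0`, and `∞` otherwise. -/
def innerDilatation (p : ℝ)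
    (A : EuclideanSpace ℝ (Fin n) →L[ℝ] EuclideanSpace ℝ (Fin n)) : ℝ≥0∞ :=
  if A.det ≠ 0 then ENNReal.ofReal (|A.det| / minNorm A ^ p)
  else if A = 0 then 1 else ⊤

/-- `K_{I,p}(x, f)`, the inner dilatation of order `p` of `f` at `x`. -/
def KIp (p : ℝ) (f : EuclideanSpace ℝ (Fin n) → EuclideanSpace ℝ (Fin n))
    (x : EuclideanSpace ℝ (Fin n)) : ℝ≥0∞ :=
  innerDilatation p (fderiv ℝ f x)

/-- Luzin's `N`-property on `D`. -/
def NProp (f : EuclideanSpace ℝ (Fin n) → EuclideanSpace ℝ (Fin n))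
    (D : Set (EuclideanSpace ℝ (Fin n))) : Prop :=
  ∀ S ⊆ D, volume S = 0 → volume (f '' S) = 0

/-- The `N⁻¹`-property on `D`. -/
def NInvProp (f : EuclideanSpace ℝ (Fin n) → EuclideanSpace ℝ (Fin n))
    (D : Set (EuclideanSpace ℝ (Fin n))) : Prop :=
  ∀ S : Set (EuclideanSpace ℝ (Fin n)), volume S = 0 → volume (D ∩ f ⁻¹' S) = 0

/-- `f` is discrete on `D`: each fiber consists of isolated points. -/
def DiscreteMap (f : EuclideanSpace ℝ (Fin n) → EuclideanSpace ℝ (Fin n))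
    (D : Set (EuclideanSpace ℝ (Fin n))) : Prop :=
  ∀ y, ∀ x ∈ D, f x = y → ∃ ε > 0, ∀ z ∈ Metric.ball x ε ∩ D, f z = y → z = x

/-- Absolute continuity of `g` on `[a, b]`. -/
def AbsContOn (g : ℝ → EuclideanSpace ℝ (Fin n)) (a b : ℝ) : Prop :=
  ∀ ε > 0, ∃ δ > 0, ∀ (k : ℕ) (u v : ℕ → ℝ),
    (∀ i < k, a ≤ u i ∧ u i ≤ v i ∧ v i ≤ b) →
    (∀ i < k, ∀ j < k, i ≠ j → Disjoint (Set.Ioo (u i) (v i)) (Set.Ioo (u j) (v j))) →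
    (∑ i ∈ Finset.range k, (v i - u i)) < δ →
    (∑ i ∈ Finset.range k, ‖g (v i) - g (u i)‖) < ε

/-- The `ACP_p⁻¹` property: for `p`-a.e. closed curve `β` in `f(D)`, every lifting `γ` of `β`
in `D` is rectifiable and its `f`-representation is absolutely continuous. -/
def ACPinv (p : ℝ) (f : EuclideanSpace ℝ (Fin n) → EuclideanSpace ℝ (Fin n))
    (D : Set (EuclideanSpace ℝ (Fin n))) : Prop :=
  modulus p {β : Curve n | β.InSet (f '' D) ∧
    ¬ ∀ γ : Curve n, γ.a = β.a → γ.b = β.b → γ.InSet D →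
        (∀ t ∈ Set.Icc γ.a γ.b, f (γ.toFun t) = β.toFun t) →
        γ.Rectifiable ∧ ∃ αs : ℝ → EuclideanSpace ℝ (Fin n),
          (∀ t ∈ Set.Icc γ.a γ.b, γ.toFun t = αs (β.lengthFun t)) ∧
          AbsContOn αs 0 β.length} = 0

/-- `f` winds the closed curve `α` `m` times around itself. -/
def Winds (f : EuclideanSpace ℝ (Fin n) → EuclideanSpace ℝ (Fin n)) (m : ℕ)
    (α : Curve n) : Prop :=
  ∃ β : Curve n, β.a = α.a ∧ β.b = α.b ∧
    (∀ t ∈ Set.Icc α.a α.b, β.toFun t = f (α.toFun t)) ∧ β.Rectifiable ∧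
    ∃ αs : ℝ → EuclideanSpace ℝ (Fin n),
      (∀ t ∈ Set.Icc α.a α.b, α.toFun t = αs (β.lengthFun t)) ∧
      ∀ (t : ℝ) (j : ℕ), 0 ≤ t → 1 ≤ j → j ≤ m - 1 →
        t + j * (β.length / m) < β.length →
        β.normalRep (t + j * (β.length / m)) = β.normalRep t ∧
        αs (t + j * (β.length / m)) ≠ αs t

/-- `f` is bi-Lipschitz on the set `S`. -/
def BiLipschitzOn (f : EuclideanSpace ℝ (Fin n) → EuclideanSpace ℝ (Fin n))
    (S : Set (EuclideanSpace ℝ (Fin n))) : Prop :=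
  ∃ M M' : ℝ, 0 < M' ∧
    (∀ x ∈ S, ∀ y ∈ S, dist (f x) (f y) ≤ M * dist x y) ∧
    (∀ x ∈ S, ∀ y ∈ S, M' * dist x y ≤ dist (f x) (f y))

/-- Encoding of `f ∈ W^{1,n}_loc(D)`: `f` is differentiable a.e. in `D` and its derivative is
locally `n`-integrable on `D` (Mathlib does not yet have Sobolev spaces). -/
def MemW1nLoc (n' : ℕ) (f : EuclideanSpace ℝ (Fin n) → EuclideanSpace ℝ (Fin n))
    (D : Set (EuclideanSpace ℝ (Fin n))) : Prop :=
  (∀ᵐ x ∂(volume.restrict D), DifferentiableAt ℝ f x) ∧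
  LocallyIntegrableOn (fun x => ‖fderiv ℝ f x‖ ^ n') D volume

/-- `f` is a mapping with bounded distortion (constant `K`) on the domain `D`. -/
def BoundedDistortion (K : ℝ) (f : EuclideanSpace ℝ (Fin n) → EuclideanSpace ℝ (Fin n))
    (D : Set (EuclideanSpace ℝ (Fin n))) : Prop :=
  ContinuousOn f D ∧ MemW1nLoc n f D ∧
  ((∀ᵐ x ∂(volume.restrict D), 0 ≤ (fderiv ℝ f x).det) ∨
   (∀ᵐ x ∂(volume.restrict D), (fderiv ℝ f x).det ≤ 0)) ∧
  (∀ᵐ x ∂(volume.restrict D), ‖fderiv ℝ f x‖ ^ n ≤ K * |(fderiv ℝ f x).det|)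

end


namespace VTM
open MeasureTheory ENNReal Set Filter Topology

variable {n : ℕ}

theorem evar_ne_top {γ : Curve n} (h : γ.Rectifiable) {s t : ℝ} (hs : γ.a ≤ s) (ht : t ≤ γ.b) :
    eVariationOn γ.toFun (Icc s t) ≠ ⊤ :=
  ne_top_of_le_ne_top h (eVariationOn.mono _ (Icc_subset_Icc hs ht))

theorem lengthFun_add {γ : Curve n} (h : γ.Rectifiable) {s t : ℝ} (hs : γ.a ≤ s) (hst : s ≤ t)
    (ht : t ≤ γ.b) :
    γ.lengthFun t = γ.lengthFun s + (eVariationOn γ.toFun (Icc s t)).toReal := by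
  unfold Curve.lengthFun
  rw [← ENNReal.toReal_add (evar_ne_top h le_rfl (hst.trans ht)) (evar_ne_top h hs ht)]
  have := eVariationOn.Icc_add_Icc γ.toFun (s := univ) hs hst (mem_univ _)
  simp only [univ_inter] at this
  rw [this]

theorem evar_eq {γ : Curve n} (h : γ.Rectifiable) {s t : ℝ} (hs : γ.a ≤ s) (hst : s ≤ t)
    (ht : t ≤ γ.b) :
    eVariationOn γ.toFun (Icc s t) = ENNReal.ofReal (γ.lengthFun t - γ.lengthFun s) := by
  rw [lengthFun_add h hs hst ht, add_sub_cancel_left, ENNReal.ofReal_toReal (evar_ne_top h hs ht)]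

theorem lengthFun_a (γ : Curve n) : γ.lengthFun γ.a = 0 := by
  unfold Curve.lengthFun
  rw [eVariationOn.subsingleton _ (by simp)]; rfl

theorem lengthFun_b (γ : Curve n) : γ.lengthFun γ.b = γ.length := rfl

theorem lengthFun_mono {γ : Curve n} (h : γ.Rectifiable) : MonotoneOn γ.lengthFun (Icc γ.a γ.b) := by
  intro s hs t ht hst
  rw [lengthFun_add h hs.1 hst ht.2]
  linarith [ENNReal.toReal_nonneg (a := eVariationOn γ.toFun (Icc s t))]

theorem length_nonneg (γ : Curve n) : 0 ≤ γ.length := ENNReal.toReal_nonneg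

theorem lengthFun_cont {γ : Curve n} (h : γ.Rectifiable) :
    ContinuousOn γ.lengthFun (Icc γ.a γ.b) := by
  intro x hx
  have hb : BoundedVariationOn γ.toFun (Icc γ.a γ.b) := h
  have h1 := hb.tendsto_eVariationOn_Icc_zero_left (x := x)
    ((γ.cont x hx).mono inter_subset_left)
  have h2 := hb.tendsto_eVariationOn_Icc_zero_right x
    ((γ.cont x hx).mono inter_subset_left)
  have h3 := h1.add h2
  rw [add_zero] at h3
  have h4 := (ENNReal.tendsto_toReal (a := 0) (by simp)).comp h3
  rw [ContinuousWithinAt, tendsto_iff_dist_tendsto_zero]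
  refine squeeze_zero' (Eventually.of_forall fun _ => dist_nonneg) ?_ h4
  filter_upwards [self_mem_nhdsWithin] with y hy
  simp only [Function.comp]
  have e1 : ∀ s t, s ∈ Icc γ.a γ.b → t ∈ Icc γ.a γ.b → Icc γ.a γ.b ∩ Icc s t = Icc s t := by
    intro s t hs ht
    exact inter_eq_right.2 (Icc_subset_Icc hs.1 ht.2)
  rw [e1 _ _ hy hx, e1 _ _ hx hy,
    ENNReal.toReal_add (evar_ne_top h hy.1 hx.2) (evar_ne_top h hx.1 hy.2)]
  have p1 := ENNReal.toReal_nonneg (a := eVariationOn γ.toFun (Icc y x))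
  have p2 := ENNReal.toReal_nonneg (a := eVariationOn γ.toFun (Icc x y))
  rw [Real.dist_eq]
  rcases le_total x y with hxy | hxy
  · rw [lengthFun_add h hx.1 hxy hy.2, add_sub_cancel_left, abs_of_nonneg p2]
    linarith
  · rw [lengthFun_add h hy.1 hxy hx.2, abs_sub_comm, add_sub_cancel_left, abs_of_nonneg p1]
    linarith

theorem lengthFun_image {γ : Curve n} (h : γ.Rectifiable) {t : ℝ} (ht : t ∈ Icc γ.a γ.b) :
    γ.lengthFun '' Icc γ.a t = Icc 0 (γ.lengthFun t) := by
  have hsub : Icc γ.a t ⊆ Icc γ.a γ.b := Icc_subset_Icc le_rfl ht.2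
  apply Subset.antisymm
  · rintro _ ⟨s, hs, rfl⟩
    exact ⟨ENNReal.toReal_nonneg, lengthFun_mono h (hsub hs) ht hs.2⟩
  · have := intermediate_value_Icc ht.1 ((lengthFun_cont h).mono hsub)
    rwa [lengthFun_a] at this

theorem lengthFun_mem {γ : Curve n} (h : γ.Rectifiable) {t : ℝ} (ht : t ∈ Icc γ.a γ.b) :
    γ.lengthFun t ∈ Icc 0 γ.length :=
  ⟨ENNReal.toReal_nonneg, lengthFun_mono h ht ⟨γ.hab, le_rfl⟩ ht.2⟩

theorem lengthFun_surj {γ : Curve n} (h : γ.Rectifiable) {s : ℝ} (hs : s ∈ Icc 0 γ.length) :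
    ∃ t ∈ Icc γ.a γ.b, γ.lengthFun t = s := by
  have := lengthFun_image h (t := γ.b) ⟨γ.hab, le_rfl⟩
  rw [lengthFun_b] at this
  rw [← this] at hs
  exact hs

theorem dist_le {γ : Curve n} (h : γ.Rectifiable) {s t : ℝ} (hs : s ∈ Icc γ.a γ.b)
    (ht : t ∈ Icc γ.a γ.b) :
    dist (γ.toFun s) (γ.toFun t) ≤ dist (γ.lengthFun s) (γ.lengthFun t) := by
  wlog hst : s ≤ t generalizing s t
  · rw [dist_comm, dist_comm (γ.lengthFun s)]
    exact this ht hs (le_of_not_ge hst)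
  have h1 := eVariationOn.edist_le γ.toFun (s := Icc s t) ⟨le_rfl, hst⟩ ⟨hst, le_rfl⟩
  rw [evar_eq h hs.1 hst ht.2, edist_dist, ENNReal.ofReal_le_ofReal_iff
    (sub_nonneg.2 (lengthFun_mono h hs ht hst))] at h1
  rw [Real.dist_eq, abs_sub_comm]
  exact h1.trans (le_abs_self _)

theorem normalRep_spec {γ : Curve n} (h : γ.Rectifiable) {s : ℝ} (hs : s ∈ Icc 0 γ.length) :
    ∃ t ∈ Icc γ.a γ.b, γ.lengthFun t = s ∧ γ.normalRep s = γ.toFun t := by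
  obtain ⟨t, ht, hts⟩ := lengthFun_surj h hs
  have hne : (γ.toFun '' {t | t ∈ Icc γ.a γ.b ∧ γ.lengthFun t = s}).Nonempty := ⟨_, t, ⟨ht, hts⟩, rfl⟩
  have hcl : IsClosed {t | t ∈ Icc γ.a γ.b ∧ γ.lengthFun t = s} :=
    (lengthFun_cont h).preimage_isClosed_of_isClosed isClosed_Icc (isClosed_singleton (x := s))
  have hm : sInf {t | t ∈ Icc γ.a γ.b ∧ γ.lengthFun t = s} ∈
      {t | t ∈ Icc γ.a γ.b ∧ γ.lengthFun t = s} :=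
    hcl.csInf_mem ⟨t, ht, hts⟩ ⟨γ.a, fun x hx => hx.1.1⟩
  exact ⟨_, hm.1, hm.2, rfl⟩

theorem normalRep_lengthFun {γ : Curve n} (h : γ.Rectifiable) {t : ℝ} (ht : t ∈ Icc γ.a γ.b) :
    γ.normalRep (γ.lengthFun t) = γ.toFun t := by
  obtain ⟨t', ht', h1, h2⟩ := normalRep_spec h (lengthFun_mem h ht)
  rw [h2]
  have := dist_le h ht' ht
  rw [h1, dist_self] at this
  exact dist_le_zero.1 this

theorem normalRep_lip {γ : Curve n} (h : γ.Rectifiable) :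
    LipschitzOnWith 1 γ.normalRep (Icc 0 γ.length) := by
  apply LipschitzOnWith.of_dist_le_mul
  intro s hs t ht
  obtain ⟨s', hs', h1, h2⟩ := normalRep_spec h hs
  obtain ⟨t', ht', h3, h4⟩ := normalRep_spec h ht
  rw [h2, h4, ← h1, ← h3]
  simpa using dist_le h hs' ht'

/-- quantities only depend on the values on the interval -/
theorem eqv {γ δ : Curve n} (ha : γ.a = δ.a) (hb : γ.b = δ.b)
    (h : ∀ t ∈ Icc δ.a δ.b, γ.toFun t = δ.toFun t) :
    (γ.Rectifiable ↔ δ.Rectifiable) ∧ γ.length = δ.length ∧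
      (∀ t ∈ Icc δ.a δ.b, γ.lengthFun t = δ.lengthFun t) := by
  have e : γ.eLength = δ.eLength := by
    unfold Curve.eLength
    rw [ha, hb]
    exact eVariationOn.congr h
  refine ⟨by simp [Curve.Rectifiable, e], by simp [Curve.length, e], fun t ht => ?_⟩
  unfold Curve.lengthFun
  rw [ha]
  congr 1
  exact eVariationOn.congr fun x hx => h x ⟨hx.1, hx.2.trans ht.2⟩

/-- The clamp of a real into `[0, c]`. -/
def clamp (c u : ℝ) : ℝ := max 0 (min u c)

theorem clamp_cont (c : ℝ) : Continuous (clamp c) := by unfold clamp; fun_prop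

theorem clamp_mem {c : ℝ} (hc : 0 ≤ c) (u : ℝ) : clamp c u ∈ Icc 0 c :=
  ⟨le_max_left _ _, max_le hc (min_le_right _ _)⟩

theorem clamp_eq {c u : ℝ} (hu : u ∈ Icc 0 c) : clamp c u = u := by
  unfold clamp
  rw [min_eq_left hu.2, max_eq_right hu.1]

theorem comp_clamp_cont {X : Type*} [TopologicalSpace X] {g : ℝ → X} {c : ℝ} (hc : 0 ≤ c)
    (hg : ContinuousOn g (Icc 0 c)) : Continuous (fun u => g (clamp c u)) :=
  hg.comp_continuous (clamp_cont c) (clamp_mem hc)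

theorem ac_of {g : ℝ → EuclideanSpace ℝ (Fin n)} {a b : ℝ} (hab : a ≤ b) (h : AbsContOn g a b) :
    AbsolutelyContinuousOnInterval g a b := by
  rw [absolutelyContinuousOnInterval_iff]
  intro ε hε
  obtain ⟨δ, hδ, H⟩ := h ε hε
  refine ⟨δ, hδ, ?_⟩
  rintro ⟨k, I⟩ ⟨h1, h2⟩ h3
  simp only [uIcc_of_le hab, Finset.mem_range] at h1 h2 h3 ⊢
  have key := H k (fun i => min (I i).1 (I i).2) (fun i => max (I i).1 (I i).2) ?_ ?_ ?_
  · refine lt_of_eq_of_lt (Finset.sum_congr rfl fun i hi => ?_) key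
    rcases le_total (I i).1 (I i).2 with h | h
    · rw [min_eq_left h, max_eq_right h, dist_comm, dist_eq_norm]
    · rw [min_eq_right h, max_eq_left h, dist_eq_norm]
  · intro i hi
    exact ⟨le_min (h1 i hi).1.1 (h1 i hi).2.1, min_le_max, max_le (h1 i hi).1.2 (h1 i hi).2.2⟩
  · intro i hi j hj hij
    have := h2 (by simpa using hi) (by simpa using hj) hij
    exact this.mono Ioo_subset_Ioc_self Ioo_subset_Ioc_self
  · refine lt_of_eq_of_lt (Finset.sum_congr rfl fun i hi => ?_) h3
    rw [max_sub_min_eq_abs, Real.dist_eq]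
    rw [abs_sub_comm]

theorem evar_le_lintegral {g : ℝ → EuclideanSpace ℝ (Fin n)} {a b : ℝ} (hab : a ≤ b)
    (h : AbsolutelyContinuousOnInterval g a b) {u v : ℝ} (hu : a ≤ u) (huv : u ≤ v) (hv : v ≤ b) :
    eVariationOn g (Icc u v) ≤ ∫⁻ x in Ioc u v, ‖deriv g x‖ₑ := by
  have hdiff : ∀ᵐ x, x ∈ uIcc a b → DifferentiableAt ℝ g x :=
    h.boundedVariationOn.ae_differentiableAt_of_mem_uIcc
  rw [uIcc_of_le hab] at hdiff
  have key : ∀ s t, a ≤ s → s ≤ t → t ≤ b → edist (g s) (g t) ≤ ∫⁻ x in Ioc s t, ‖deriv g x‖ₑ := by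
    intro s t hs hst ht
    by_cases hz : g t - g s = 0
    · rw [sub_eq_zero.1 hz, edist_self]; exact bot_le
    set w : EuclideanSpace ℝ (Fin n) := (‖g t - g s‖⁻¹ : ℝ) • (g t - g s) with hw
    have hwn : ‖w‖ = 1 := by
      rw [hw, norm_smul, norm_inv, norm_norm, inv_mul_cancel₀ (norm_ne_zero_iff.2 hz)]
    have hac : AbsolutelyContinuousOnInterval (fun x => inner ℝ w (g x)) s t := by
      have h' : AbsolutelyContinuousOnInterval g s t := h.mono (by
        rw [uIcc_of_le hab, uIcc_of_le hst]; exact Icc_subset_Icc hs ht)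
      rw [absolutelyContinuousOnInterval_iff] at h' ⊢
      intro ε hε
      obtain ⟨δ, hδ, H⟩ := h' ε hε
      refine ⟨δ, hδ, fun E hE hEd => lt_of_le_of_lt (Finset.sum_le_sum fun i _ => ?_) (H E hE hEd)⟩
      rw [Real.dist_eq, ← inner_sub_right, dist_eq_norm]
      refine (abs_real_inner_le_norm _ _).trans ?_
      rw [hwn, one_mul]
    have hI := hac.integral_deriv_eq_sub
    have e1 : inner ℝ w (g t) - inner ℝ w (g s) = ‖g t - g s‖ := by
      rw [← inner_sub_right, hw, real_inner_smul_left, real_inner_self_eq_norm_sq, sq,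
        inv_mul_cancel_left₀ (norm_ne_zero_iff.2 hz)]
    rw [e1, intervalIntegral.integral_of_le hst] at hI
    have : edist (g s) (g t) = ‖∫ x in Ioc s t, deriv (fun x => inner ℝ w (g x)) x‖ₑ := by
      rw [hI, edist_comm, edist_eq_enorm_sub, enorm_norm]
    rw [this]
    refine (enorm_integral_le_lintegral_enorm _).trans ?_
    apply lintegral_mono_ae
    rw [ae_restrict_iff' measurableSet_Ioc]
    filter_upwards [hdiff] with x hx hxs
    have hd := hx ⟨hs.trans hxs.1.le, hxs.2.trans ht⟩
    have : deriv (fun x => inner ℝ w (g x)) x = inner ℝ w (deriv g x) := by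
      have := (hasDerivAt_const x w).inner ℝ hd.hasDerivAt
      simpa using this.deriv
    rw [this, enorm_le_iff_norm_le]
    refine (norm_inner_le_norm _ _).trans ?_
    rw [hwn, one_mul]
  unfold eVariationOn
  refine iSup_le ?_
  rintro ⟨N, ⟨q, hq, hqm⟩⟩
  simp only
  have : ∀ N, ∑ i ∈ Finset.range N, edist (g (q (i + 1))) (g (q i)) ≤
      ∫⁻ x in Ioc (q 0) (q N), ‖deriv g x‖ₑ := by
    intro N
    induction N with
    | zero => simp
    | succ N ih =>
      rw [Finset.sum_range_succ, ← Ioc_union_Ioc_eq_Ioc (hq (Nat.zero_le N)) (hq (Nat.le_succ N)),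
        lintegral_union measurableSet_Ioc (by
          rw [disjoint_left]; intro x h1 h2; exact absurd h1.2 (not_le.2 h2.1))]
      gcongr
      rw [edist_comm]
      exact key _ _ (hu.trans (hqm N).1) (hq (Nat.le_succ N)) ((hqm _).2.trans hv)
  exact (this N).trans (lintegral_mono_set (Ioc_subset_Ioc (hqm 0).1 (hqm N).2))

theorem lintegral_deriv_lt_top {g : ℝ → EuclideanSpace ℝ (Fin n)} {a b : ℝ} (hab : a ≤ b)
    (h : AbsolutelyContinuousOnInterval g a b) : ∫⁻ x in Ioc a b, ‖deriv g x‖ₑ < ⊤ := by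
  have hdiff : ∀ᵐ x, x ∈ uIcc a b → DifferentiableAt ℝ g x :=
    h.boundedVariationOn.ae_differentiableAt_of_mem_uIcc
  rw [uIcc_of_le hab] at hdiff
  have hac : ∀ i, AbsolutelyContinuousOnInterval (fun x => g x i) a b := by
    intro i
    have h' := h
    rw [absolutelyContinuousOnInterval_iff] at h' ⊢
    intro ε hε
    obtain ⟨δ, hδ, H⟩ := h' ε hε
    refine ⟨δ, hδ, fun E hE hEd => lt_of_le_of_lt (Finset.sum_le_sum fun j _ => ?_) (H E hE hEd)⟩
    rw [Real.dist_eq, dist_eq_norm]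
    simpa using PiLp.norm_apply_le (g (E.2 j).1 - g (E.2 j).2) i
  have hintg : ∀ i, ∫⁻ x in Ioc a b, ‖deriv (fun x => g x i) x‖ₑ < ⊤ := by
    intro i
    have := (hac i).intervalIntegrable_deriv
    rw [intervalIntegrable_iff_integrableOn_Ioc_of_le hab] at this
    exact this.2
  have : ∫⁻ x in Ioc a b, ‖deriv g x‖ₑ ≤
      ∫⁻ x in Ioc a b, ∑ i, ‖deriv (fun x => g x i) x‖ₑ := by
    apply lintegral_mono_ae
    rw [ae_restrict_iff' measurableSet_Ioc]
    filter_upwards [hdiff] with x hx hxs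
    have hd := (hx ⟨hxs.1.le, hxs.2⟩).hasDerivAt
    have e : ∀ i, deriv (fun x => g x i) x = (deriv g x) i := fun i =>
      ((EuclideanSpace.proj i : EuclideanSpace ℝ (Fin n) →L[ℝ] ℝ).hasFDerivAt.comp_hasDerivAt x hd).deriv
    simp only [e]
    set v := deriv g x
    have : v = ∑ i, EuclideanSpace.single i (v i) := by
      ext j; simp [Finset.sum_apply]
    conv_lhs => rw [this]
    refine (enorm_sum_le _ _).trans (Finset.sum_le_sum fun i _ => ?_)
    rw [enorm_le_iff_norm_le]
    simp
  refine this.trans_lt ?_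
  rw [lintegral_finsetSum _ (fun i _ => (measurable_deriv _).enorm)]
  exact ENNReal.sum_lt_top.2 fun i _ => hintg i

end VTM


namespace VTM
open MeasureTheory ENNReal Set Filter Topology

variable {n : ℕ}

theorem lineIntegral_le {c : ℝ} (hc : 0 ≤ c) {g : ℝ → EuclideanSpace ℝ (Fin n)}
    (hcont : ContinuousOn g (Icc 0 c))
    (hac : AbsolutelyContinuousOnInterval g 0 c) {ρ : EuclideanSpace ℝ (Fin n) → ℝ≥0∞}
    (hρ : Measurable ρ) :
    lineIntegral ρ ⟨0, c, hc, g, hcont⟩ ≤ ∫⁻ u in Ioc 0 c, ‖deriv g u‖ₑ * ρ (g u) := by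
  set A : Curve n := ⟨0, c, hc, g, hcont⟩ with hA
  have hr : A.Rectifiable := by
    have := hac.boundedVariationOn
    rw [uIcc_of_le hc] at this
    exact this
  have hL := length_nonneg A
  set L := A.length with hLdef
  set κ : Measure ℝ := (volume.restrict (Ioc 0 c)).withDensity (fun u => ‖deriv g u‖ₑ) with hκ
  have hgm : Measurable (fun u => ‖deriv g u‖ₑ) := (measurable_deriv g).enorm
  have : IsFiniteMeasure κ := isFiniteMeasure_withDensity (lintegral_deriv_lt_top hc hac).ne
  set φ : ℝ → ℝ := fun u => A.lengthFun (clamp c u) with hφ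
  have hφc : Continuous φ := comp_clamp_cont hc (lengthFun_cont hr)
  set ν : Measure ℝ := κ.map φ with hν
  have : IsFiniteMeasure ν := inferInstance
  set μ : Measure ℝ := volume.restrict (Icc 0 L) with hμ
  have key : ∀ s1 s2, s1 ∈ Icc 0 L → s2 ∈ Icc 0 L → s1 ≤ s2 →
      ENNReal.ofReal (s2 - s1) ≤ ν (Icc s1 s2) := by
    intro s1 s2 h1 h2 h12
    rcases h12.eq_or_lt with rfl | hlt
    · simp
    obtain ⟨u1, hu1, rfl⟩ := lengthFun_surj hr h1
    obtain ⟨u2, hu2, rfl⟩ := lengthFun_surj hr h2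
    have hu : u1 ≤ u2 := by
      by_contra hcon
      exact absurd (lengthFun_mono hr hu2 hu1 (not_le.1 hcon).le) (not_le.2 hlt)
    rw [hν, Measure.map_apply hφc.measurable measurableSet_Icc]
    have hsub : Ioc u1 u2 ⊆ φ ⁻¹' Icc (A.lengthFun u1) (A.lengthFun u2) := by
      intro u hu'
      have hu0 : u ∈ Icc 0 c := ⟨hu1.1.trans hu'.1.le, hu'.2.trans hu2.2⟩
      simp only [mem_preimage, hφ]
      rw [clamp_eq hu0]
      exact ⟨lengthFun_mono hr hu1 hu0 hu'.1.le, lengthFun_mono hr hu0 hu2 hu'.2⟩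
    refine le_trans ?_ (measure_mono hsub)
    rw [hκ, withDensity_apply _ measurableSet_Ioc, Measure.restrict_restrict measurableSet_Ioc,
      inter_eq_left.2 (Ioc_subset_Ioc hu1.1 hu2.2), ← evar_eq hr hu1.1 hu hu2.2]
    exact evar_le_lintegral hc hac hu1.1 hu hu2.2
  have hle : μ ≤ ν := by
    intro s
    refine (Besicovitch.vitaliFamily μ).measure_le_of_frequently_le ν Measure.AbsolutelyContinuous.rfl s ?_
    intro x _
    refine (Besicovitch.tendsto_filterAt μ x).frequently (Frequently.of_forall fun r => ?_)
    rw [hμ, Measure.restrict_apply Metric.isClosed_closedBall.measurableSet, Real.closedBall_eq_Icc,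
      Icc_inter_Icc]
    rw [Real.volume_Icc]
    by_cases hh : (max (x - r) 0) ≤ min (x + r) L
    · refine (key _ _ ⟨le_max_right _ _, hh.trans (min_le_right _ _)⟩
        ⟨(le_max_right _ _).trans hh, min_le_right _ _⟩ hh).trans (measure_mono ?_)
      exact Icc_subset_Icc (le_max_left _ _) (min_le_left _ _)
    · rw [ENNReal.ofReal_of_nonpos (by linarith [not_le.1 hh])]
      exact bot_le
  have hNc : Continuous (fun s => A.normalRep (clamp L s)) :=
    comp_clamp_cont hL (normalRep_lip hr).continuousOn
  have hRm : Measurable (fun s => ρ (A.normalRep (clamp L s))) := hρ.comp hNc.measurable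
  calc lineIntegral ρ A = ∫⁻ s, ρ (A.normalRep (clamp L s)) ∂μ := by
        unfold lineIntegral
        apply setLIntegral_congr_fun measurableSet_Icc
        intro s hs
        simp only
        rw [clamp_eq hs]
    _ ≤ ∫⁻ s, ρ (A.normalRep (clamp L s)) ∂ν := lintegral_mono' hle le_rfl
    _ = ∫⁻ u, ρ (A.normalRep (clamp L (φ u))) ∂κ := lintegral_map hRm hφc.measurable
    _ = ∫⁻ u in Ioc 0 c, ‖deriv g u‖ₑ * ρ (A.normalRep (clamp L (φ u))) := by
        exact lintegral_withDensity_eq_lintegral_mul _ hgm (hRm.comp hφc.measurable)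
    _ = ∫⁻ u in Ioc 0 c, ‖deriv g u‖ₑ * ρ (g u) := by
        apply setLIntegral_congr_fun measurableSet_Ioc
        intro u hu
        have hu0 : u ∈ Icc 0 c := Ioc_subset_Icc_self hu
        simp only [hφ]
        rw [clamp_eq hu0, clamp_eq (lengthFun_mem hr hu0), normalRep_lengthFun hr hu0]

/-- Reparametrisation by the length function of another curve. -/
theorem lineIntegral_reparam {α β : Curve n} (ha : β.a = α.a) (hb : β.b = α.b)
    (hβ : β.Rectifiable) (hα : α.Rectifiable) {g : ℝ → EuclideanSpace ℝ (Fin n)}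
    (hg : ∀ t ∈ Icc α.a α.b, α.toFun t = g (β.lengthFun t))
    (hcont : ContinuousOn g (Icc 0 β.length)) (ρ : EuclideanSpace ℝ (Fin n) → ℝ≥0∞) :
    lineIntegral ρ α = lineIntegral ρ ⟨0, β.length, length_nonneg β, g, hcont⟩ := by
  set A : Curve n := ⟨0, β.length, length_nonneg β, g, hcont⟩ with hA
  have e : ∀ t ∈ Icc α.a α.b, eVariationOn α.toFun (Icc α.a t) =
      eVariationOn g (Icc 0 (β.lengthFun t)) := by
    intro t ht
    have ht' : t ∈ Icc β.a β.b := by rw [ha, hb]; exact ht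
    rw [← lengthFun_image hβ ht', ← eVariationOn.comp_eq_of_monotoneOn, ha]
    · exact eVariationOn.congr fun x hx => hg x ⟨hx.1, hx.2.trans ht.2⟩
    · exact (lengthFun_mono hβ).mono (Icc_subset_Icc le_rfl ht'.2)
  have hbm : α.b ∈ Icc α.a α.b := ⟨α.hab, le_rfl⟩
  have e2 : A.eLength = α.eLength := by
    have := e α.b hbm
    rw [← hb, lengthFun_b] at this
    unfold Curve.eLength
    rw [← hb, this]
  have hAr : A.Rectifiable := by unfold Curve.Rectifiable; rw [e2]; exact hα
  have e3 : A.length = α.length := by unfold Curve.length; rw [e2]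
  unfold lineIntegral
  rw [e3]
  apply setLIntegral_congr_fun measurableSet_Icc
  intro s hs
  simp only
  congr 1
  obtain ⟨t, ht, h1, h2⟩ := normalRep_spec hα hs
  have ht' : t ∈ Icc β.a β.b := by rw [ha, hb]; exact ht
  rw [h2, hg t ht]
  have h3 : A.lengthFun (β.lengthFun t) = s := by
    rw [← h1]; unfold Curve.lengthFun; rw [e t ht]; rfl
  rw [← h3, normalRep_lengthFun hAr (lengthFun_mem hβ ht')]

end VTM


namespace VTM
open MeasureTheory ENNReal Set Filter Topology

variable {n : ℕ}

/-- Shorthand for Euclidean space. -/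
abbrev Eu (n : ℕ) := EuclideanSpace ℝ (Fin n)

theorem sphere_nonempty (hn : 2 ≤ n) : ({h : Eu n | ‖h‖ = 1}).Nonempty :=
  ⟨EuclideanSpace.single ⟨0, by omega⟩ 1, by simp⟩

theorem minNorm_bdd (A : Eu n →L[ℝ] Eu n) : BddBelow ((fun h => ‖A h‖) '' {h | ‖h‖ = 1}) :=
  ⟨0, by rintro _ ⟨h, _, rfl⟩; exact norm_nonneg _⟩

theorem minNorm_le (A : Eu n →L[ℝ] Eu n) {h : Eu n} (hh : ‖h‖ = 1) : minNorm A ≤ ‖A h‖ :=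
  csInf_le (minNorm_bdd A) ⟨h, hh, rfl⟩

theorem minNorm_mul_le (A : Eu n →L[ℝ] Eu n) (v : Eu n) : minNorm A * ‖v‖ ≤ ‖A v‖ := by
  by_cases hv : v = 0
  · simp [hv]
  have hv' := norm_ne_zero_iff.2 hv
  have := minNorm_le A (h := (‖v‖⁻¹ : ℝ) • v) (by
    rw [norm_smul, norm_inv, norm_norm, inv_mul_cancel₀ hv'])
  rw [map_smul, norm_smul, norm_inv, norm_norm] at this
  calc minNorm A * ‖v‖ ≤ (‖v‖⁻¹ * ‖A v‖) * ‖v‖ := by gcongr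
    _ = ‖A v‖ := by field_simp

theorem minNorm_pos (hn : 2 ≤ n) {A : Eu n →L[ℝ] Eu n} (hA : A.det ≠ 0) : 0 < minNorm A := by
  set e := A.toContinuousLinearEquivOfDetNeZero hA with he
  have hle : ∀ h : Eu n, ‖h‖ = 1 → 1 ≤ ‖(e.symm : Eu n →L[ℝ] Eu n)‖ * ‖A h‖ := by
    intro h hh
    have h1 := (e.symm : Eu n →L[ℝ] Eu n).le_opNorm (A h)
    have h2 : (e.symm : Eu n →L[ℝ] Eu n) (A h) = h := by
      have : A h = e h := by simp [he]
      rw [this]; simp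
    rwa [h2, hh] at h1
  obtain ⟨h0, hh0⟩ := sphere_nonempty hn
  have hpos : 0 < ‖(e.symm : Eu n →L[ℝ] Eu n)‖ := by
    by_contra hcon
    have : ‖(e.symm : Eu n →L[ℝ] Eu n)‖ = 0 := le_antisymm (not_lt.1 hcon) (norm_nonneg _)
    have := hle h0 hh0
    simp_all
    linarith
  refine lt_of_lt_of_le (inv_pos.2 hpos) (le_csInf ((sphere_nonempty hn).image _) ?_)
  rintro _ ⟨h, hh, rfl⟩
  rw [inv_le_iff_one_le_mul₀' hpos]
  exact hle h hh

theorem minNorm_continuous (hn : 2 ≤ n) : Continuous (minNorm : (Eu n →L[ℝ] Eu n) → ℝ) := by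
  have key : ∀ A B : Eu n →L[ℝ] Eu n, minNorm A ≤ minNorm B + dist A B := by
    intro A B
    rw [← sub_le_iff_le_add]
    refine le_csInf ((sphere_nonempty hn).image _) ?_
    rintro _ ⟨h, hh, rfl⟩
    have h1 := minNorm_le A hh
    have h2 : ‖A h‖ ≤ ‖B h‖ + ‖(A - B) h‖ := by
      have := norm_add_le (B h) ((A - B) h)
      simpa using this
    have h3 := (A - B).le_opNorm h
    rw [hh, mul_one] at h3
    rw [dist_eq_norm]
    simp only
    linarith
  exact (LipschitzWith.of_le_add key).continuous

/-- The good set. -/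
def good (f : Eu n → Eu n) (D : Set (Eu n)) : Set (Eu n) :=
  D ∩ ({x | DifferentiableAt ℝ f x} ∩ {x | (fderiv ℝ f x).det ≠ 0})

theorem good_meas (f : Eu n → Eu n) {D : Set (Eu n)} (hD : IsOpen D) :
    MeasurableSet (good f D) := by
  refine hD.measurableSet.inter ((measurableSet_of_differentiableAt ℝ f).inter ?_)
  have : Measurable fun x => (fderiv ℝ f x).det :=
    ContinuousLinearMap.continuous_det.measurable.comp (measurable_fderiv ℝ f)
  exact (this (measurableSet_singleton 0)).compl

theorem good_image_null {f : Eu n → Eu n} {D : Set (Eu n)}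
    (hdiff : ∀ᵐ x ∂(volume.restrict D), DifferentiableAt ℝ f x) (hD : IsOpen D)
    (hN : NProp f D) (hNinv : NInvProp f D) : volume (f '' (D \ good f D)) = 0 := by
  apply hN _ sdiff_subset
  set Z : Set (Eu n) := D ∩ ({x | DifferentiableAt ℝ f x} ∩ {x | (fderiv ℝ f x).det = 0}) with hZ
  have h1 : volume (f '' Z) = 0 :=
    addHaar_image_eq_zero_of_det_fderivWithin_eq_zero volume
      (f' := fderiv ℝ f) (fun x hx => hx.2.1.hasFDerivAt.hasFDerivWithinAt) (fun x hx => hx.2.2)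
  have h2 := hNinv _ h1
  have h3 : volume (D ∩ {x | ¬ DifferentiableAt ℝ f x}) = 0 := by
    rw [ae_restrict_iff' hD.measurableSet, ae_iff] at hdiff
    refine measure_mono_null ?_ hdiff
    rintro x ⟨hx, hx'⟩
    simpa using ⟨hx, hx'⟩
  refine measure_mono_null ?_ (measure_union_null h2 h3)
  rintro x ⟨hx, hx'⟩
  by_cases hd : DifferentiableAt ℝ f x
  · left
    refine ⟨hx, x, ⟨hx, hd, ?_⟩, rfl⟩
    by_contra hcon
    exact hx' ⟨hx, hd, hcon⟩
  · right; exact ⟨hx, hd⟩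

theorem exists_pieces (hn : 2 ≤ n) (f : Eu n → Eu n) {D : Set (Eu n)} (hD : IsOpen D) :
    ∃ T : ℕ → Set (Eu n), Pairwise (Function.onFun Disjoint T) ∧ (∀ i, MeasurableSet (T i)) ∧
      (⋃ i, T i) = good f D ∧ ∀ i, InjOn f (T i) := by
  set r : (Eu n →L[ℝ] Eu n) → NNReal := fun A =>
    if 0 < minNorm A then (minNorm A / 2).toNNReal else 1 with hr
  obtain ⟨t, A, h1, h2, h3, h4, h5⟩ := exists_partition_approximatesLinearOn_of_hasFDerivWithinAt
    f (good f D) (fderiv ℝ f) (fun x hx => hx.2.1.hasFDerivAt.hasFDerivWithinAt) r (by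
      intro A
      simp only [hr]
      split_ifs with h
      · simpa using h
      · simp)
  refine ⟨fun i => good f D ∩ t i, ?_, fun i => (good_meas f hD).inter (h2 i), ?_, ?_⟩
  · intro i j hij
    exact (h1 hij).mono inter_subset_right inter_subset_right
  · rw [← inter_iUnion]; exact inter_eq_left.2 h3
  · intro i x hx y hy hxy
    obtain ⟨z, hz, hAz⟩ := h5 ⟨x, hx.1⟩ i
    have hpos : 0 < minNorm (A i) := by rw [hAz]; exact minNorm_pos hn hz.2.2
    have h6 := h4 i x hx y hy
    rw [hxy, sub_self, zero_sub, norm_neg] at h6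
    have h7 : (r (A i) : ℝ) = minNorm (A i) / 2 := by
      simp only [hr, if_pos hpos]
      exact Real.coe_toNNReal _ (by linarith)
    rw [h7] at h6
    have h8 := minNorm_mul_le (A i) (x - y)
    have h9 : ‖x - y‖ ≤ 0 := by
      by_contra hcon
      nlinarith [not_le.1 hcon]
    exact sub_eq_zero.1 (norm_le_zero_iff.1 h9)

theorem exists_transfer {f : Eu n → Eu n} {S : Set (Eu n)} (hS : MeasurableSet S)
    (hf : ContinuousOn f S) (hinj : InjOn f S) {H : Eu n → ℝ≥0∞} (hH : Measurable H) :
    ∃ k : Eu n → ℝ≥0∞, Measurable k ∧ (∀ x ∈ S, k (f x) = H x) ∧ ∀ y ∉ f '' S, k y = 0 := by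
  obtain ⟨k, hk, hke⟩ := (hf.measurableEmbedding hS hinj).exists_measurable_extend
    (g := fun x : S => H x) (hH.comp measurable_subtype_coe) (fun _ => ⟨0⟩)
  refine ⟨(f '' S).indicator k, hk.indicator (hS.image_of_continuousOn_injOn hf hinj), ?_, ?_⟩
  · intro x hx
    rw [indicator_of_mem (mem_image_of_mem f hx)]
    exact congrFun hke ⟨x, hx⟩
  · intro y hy
    exact indicator_of_notMem hy _

/-- The density used in the change of variables. -/
noncomputable def dens (f : Eu n → Eu n) (ρ : Eu n → ℝ≥0∞) (x : Eu n) : ℝ≥0∞ :=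
  (ENNReal.ofReal (minNorm (fderiv ℝ f x)))⁻¹ * ρ x

theorem dens_meas (hn : 2 ≤ n) (f : Eu n → Eu n) {ρ : Eu n → ℝ≥0∞} (hρ : Measurable ρ) :
    Measurable (dens f ρ) :=
  (((minNorm_continuous hn).measurable.comp (measurable_fderiv ℝ f)).ennreal_ofReal.inv).mul hρ

theorem det_mul_dens (hn : 2 ≤ n) {f : Eu n → Eu n} {D : Set (Eu n)} {ρ : Eu n → ℝ≥0∞} {p : ℝ}
    (hp : 1 ≤ p) {x : Eu n} (hx : x ∈ good f D) :
    ENNReal.ofReal |(fderiv ℝ f x).det| * dens f ρ x ^ p = KIp p f x * ρ x ^ p := by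
  have hd : (fderiv ℝ f x).det ≠ 0 := hx.2.2
  have hl := minNorm_pos hn hd
  unfold KIp innerDilatation dens
  rw [if_pos hd, ENNReal.mul_rpow_of_nonneg _ _ (by linarith), ← mul_assoc,
    ENNReal.ofReal_div_of_pos (Real.rpow_pos_of_pos hl p), ENNReal.inv_rpow,
    ENNReal.ofReal_rpow_of_pos hl, div_eq_mul_inv]

theorem exists_density (hn : 2 ≤ n) {f : Eu n → Eu n} {D : Set (Eu n)} (hD : IsOpen D)
    (hf : ContinuousOn f D) {p : ℝ} (hp : 1 ≤ p) {m : ℕ} (hm : 0 < m) {ρ : Eu n → ℝ≥0∞}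
    (hρ : Measurable ρ) :
    ∃ R : Eu n → ℝ≥0∞, Measurable R ∧
      (∫⁻ y, R y ^ p ≤ (m : ℝ≥0∞)⁻¹ * ∫⁻ x in D, KIp p f x * ρ x ^ p) ∧
      ∀ y, ∀ s : Finset (Eu n), s.card ≤ m → (∀ x ∈ s, x ∈ good f D ∧ f x = y) →
        ∑ x ∈ s, dens f ρ x ≤ m * R y := by
  have hp0 : 0 < p := by linarith
  have hm0 : (m : ℝ≥0∞) ≠ 0 := by exact_mod_cast hm.ne'
  have hmt : (m : ℝ≥0∞) ≠ ⊤ := ENNReal.natCast_ne_top m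
  obtain ⟨T, hTd, hTm, hTu, hTi⟩ := exists_pieces hn f hD
  have hTg : ∀ i, T i ⊆ good f D := fun i => hTu ▸ subset_iUnion T i
  have hTc : ∀ i, ContinuousOn f (T i) := fun i => hf.mono ((hTg i).trans inter_subset_left)
  choose k hkm hk1 hk0 using fun i => exists_transfer (hTm i) (hTc i) (hTi i) (dens_meas hn f hρ)
  have hintg : ∀ i, ∫⁻ y, k i y ^ p = ∫⁻ x in T i, KIp p f x * ρ x ^ p := by
    intro i
    have hmeas := (hTm i).image_of_continuousOn_injOn (hTc i) (hTi i)
    have e1 : ∫⁻ y, k i y ^ p = ∫⁻ y in f '' T i, k i y ^ p := by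
      rw [← lintegral_indicator hmeas]
      refine lintegral_congr fun y => ?_
      by_cases hy : y ∈ f '' T i
      · rw [indicator_of_mem hy]
      · rw [indicator_of_notMem hy, hk0 i y hy, ENNReal.zero_rpow_of_pos hp0]
    rw [e1, lintegral_image_eq_lintegral_abs_det_fderiv_mul volume (hTm i)
      (f' := fderiv ℝ f) (fun x hx => (hTg i hx).2.1.hasFDerivAt.hasFDerivWithinAt) (hTi i)]
    apply setLIntegral_congr_fun (hTm i)
    intro x hx
    simp only
    rw [hk1 i x hx, det_mul_dens hn hp (hTg i hx)]
  refine ⟨fun y => ⨆ I : {I : Finset ℕ // I.card ≤ m}, (m : ℝ≥0∞)⁻¹ * ∑ i ∈ I.1, k i y, ?_, ?_, ?_⟩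
  · exact Measurable.iSup fun I => (Finset.measurable_sum _ fun i _ => hkm i).const_mul _
  · have hpt : ∀ y, (⨆ I : {I : Finset ℕ // I.card ≤ m}, (m : ℝ≥0∞)⁻¹ * ∑ i ∈ I.1, k i y) ^ p ≤
        (m : ℝ≥0∞)⁻¹ * ∑' i, k i y ^ p := by
      intro y
      rw [← ENNReal.le_rpow_inv_iff hp0]
      refine iSup_le fun I => ?_
      rw [ENNReal.le_rpow_inv_iff hp0, ENNReal.mul_rpow_of_nonneg _ _ hp0.le]
      calc (m : ℝ≥0∞)⁻¹ ^ p * (∑ i ∈ I.1, k i y) ^ p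
          ≤ (m : ℝ≥0∞)⁻¹ ^ p * ((m : ℝ≥0∞) ^ (p - 1) * ∑' i, k i y ^ p) := by
            gcongr
            refine (ENNReal.rpow_sum_le_const_mul_sum_rpow I.1 (fun i => k i y) hp).trans ?_
            gcongr
            · exact I.2
            · exact ENNReal.sum_le_tsum _
        _ = (m : ℝ≥0∞)⁻¹ * ∑' i, k i y ^ p := by
            rw [← mul_assoc, ENNReal.inv_rpow, ← ENNReal.rpow_neg, ← ENNReal.rpow_add _ _ hm0 hmt,
              show -p + (p - 1) = -1 by ring, ENNReal.rpow_neg_one]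
    calc ∫⁻ y, _ ≤ ∫⁻ y, (m : ℝ≥0∞)⁻¹ * ∑' i, k i y ^ p := lintegral_mono hpt
      _ = (m : ℝ≥0∞)⁻¹ * ∑' i, ∫⁻ y, k i y ^ p := by
          rw [lintegral_const_mul' _ _ (ENNReal.inv_ne_top.2 hm0),
            lintegral_tsum fun i => ((hkm i).pow_const p).aemeasurable]
      _ = (m : ℝ≥0∞)⁻¹ * ∫⁻ x in good f D, KIp p f x * ρ x ^ p := by
          rw [← hTu, lintegral_iUnion hTm hTd]
          simp only [hintg]
      _ ≤ _ := by
          gcongr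
          exact inter_subset_left
  · intro y s hs hsy
    have hex : ∀ x ∈ s, ∃ i, x ∈ T i := fun x hx => mem_iUnion.1 (hTu ▸ (hsy x hx).1)
    choose! ι hι using hex
    have hinj : Set.InjOn ι s := by
      intro x hx x' hx' hxx
      have h1 := hι x hx
      have h2 := hι x' hx'
      rw [← hxx] at h2
      exact hTi _ h1 h2 ((hsy x hx).2.trans (hsy x' hx').2.symm)
    have e : ∑ x ∈ s, dens f ρ x = ∑ i ∈ s.image ι, k i y := by
      rw [Finset.sum_image hinj]
      refine Finset.sum_congr rfl fun x hx => ?_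
      rw [← (hsy x hx).2, hk1 _ x (hι x hx)]
    have hle := le_iSup (fun I : {I : Finset ℕ // I.card ≤ m} => (m : ℝ≥0∞)⁻¹ * ∑ i ∈ I.1, k i y)
      ⟨s.image ι, Finset.card_image_le.trans hs⟩
    calc ∑ x ∈ s, dens f ρ x = m * ((m : ℝ≥0∞)⁻¹ * ∑ i ∈ s.image ι, k i y) := by
          rw [e, ← mul_assoc, ENNReal.mul_inv_cancel hm0 hmt, one_mul]
      _ ≤ _ := by gcongr

theorem lintegral_Ico_split (H : ℝ → ℝ≥0∞) {h : ℝ} (hh : 0 ≤ h) (m : ℕ) :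
    ∫⁻ u in Ico 0 (m * h), H u = ∑ j ∈ Finset.range m, ∫⁻ t in Ico 0 h, H (t + j * h) := by
  induction m with
  | zero => simp
  | succ m ih =>
    have h0 : (0 : ℝ) ≤ m * h := by positivity
    rw [Finset.sum_range_succ, ← ih, ← Ico_union_Ico_eq_Ico h0
      (show (m : ℝ) * h ≤ ((m + 1 : ℕ) : ℝ) * h by push_cast; nlinarith),
      lintegral_union measurableSet_Ico (by
          rw [disjoint_left]; intro x h1 h2; exact absurd h2.1 (not_le.2 h1.2))]
    congr 1
    have hmp := measurePreserving_add_right (volume : Measure ℝ) (m * h)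
    have := hmp.setLIntegral_comp_preimage_emb (measurableEmbedding_addRight _) H
      (Ico (m * h) (((m + 1 : ℕ) : ℝ) * h))
    rw [← this]
    congr 2
    ext x
    simp only [mem_Ico, mem_preimage]
    push_cast
    constructor <;> rintro ⟨h1, h2⟩ <;> constructor <;> linarith

end VTM

namespace VTM
open MeasureTheory ENNReal Set Filter Topology
variable {n : ℕ}

theorem normalRep_eqv {γ δ : Curve n} (ha : γ.a = δ.a) (hb : γ.b = δ.b)
    (h : ∀ t ∈ Icc δ.a δ.b, γ.toFun t = δ.toFun t) (hδ : δ.Rectifiable) :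
    ∀ s ∈ Icc 0 δ.length, γ.normalRep s = δ.normalRep s := by
  obtain ⟨h1, h2, h3⟩ := eqv ha hb h
  intro s hs
  obtain ⟨t, ht, rfl⟩ := lengthFun_surj hδ hs
  rw [normalRep_lengthFun hδ ht, ← h3 t ht, normalRep_lengthFun (h1.2 hδ) (by rwa [ha, hb]), h t ht]

/-- Key estimate along a single curve. -/
theorem key (hn : 2 ≤ n) {f : Eu n → Eu n} {D : Set (Eu n)} {m : ℕ} (hm : 0 < m)
    {ρ R : Eu n → ℝ≥0∞} (hρ : Measurable ρ) (hR : Measurable R)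
    (hRs : ∀ y, ∀ s : Finset (Eu n), s.card ≤ m → (∀ x ∈ s, x ∈ good f D ∧ f x = y) →
        ∑ x ∈ s, dens f ρ x ≤ m * R y)
    {c : ℝ} (hc : 0 ≤ c) {g b : ℝ → Eu n} (hcont : ContinuousOn g (Icc 0 c))
    (hac : AbsolutelyContinuousOnInterval g 0 c)
    (hfg : ∀ u ∈ Icc 0 c, f (g u) = b u) (hb : LipschitzOnWith 1 b (Icc 0 c))
    (hgood : ∀ᵐ u, u ∈ Icc 0 c → g u ∈ good f D)
    (hw : ∀ (t : ℝ) (j : ℕ), 0 ≤ t → 1 ≤ j → j ≤ m - 1 → t + j * (c / m) < c →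
        b (t + j * (c / m)) = b t ∧ g (t + j * (c / m)) ≠ g t) :
    ∫⁻ u in Ioc 0 c, ‖deriv g u‖ₑ * ρ (g u) ≤ ∫⁻ u in Icc 0 c, R (b u) := by
  have hm' : (0:ℝ) < m := by exact_mod_cast hm
  set h := c / m with hh
  have hmh : m * h = c := by rw [hh]; field_simp
  have hh0 : 0 ≤ h := by positivity
  -- step 1
  have s1 : ∫⁻ u in Ioc 0 c, ‖deriv g u‖ₑ * ρ (g u) ≤ ∫⁻ u in Ico 0 c, dens f ρ (g (clamp c u)) := by
    rw [← restrict_Ioo_eq_restrict_Ioc, ← restrict_Ioo_eq_restrict_Ico]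
    refine setLIntegral_mono_ae' measurableSet_Ioo ?_
    filter_upwards [hgood, hac.boundedVariationOn.ae_differentiableAt_of_mem_uIcc] with u hu1 hu2 hu
    have huc : u ∈ Icc 0 c := Ioo_subset_Icc_self hu
    rw [uIcc_of_le hc] at hu2
    have hg := hu1 huc
    have hd := hu2 huc
    rw [clamp_eq huc]
    have hl := minNorm_pos hn hg.2.2
    have hcomp : HasDerivAt (fun v => f (g v)) (fderiv ℝ f (g u) (deriv g u)) u :=
      hg.2.1.hasFDerivAt.comp_hasDerivAt u hd.hasDerivAt
    have hnhds : Icc 0 c ∈ 𝓝 u := Icc_mem_nhds hu.1 hu.2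
    have hlip : LipschitzOnWith 1 (fun v => f (g v)) (Icc 0 c) := by
      intro x hx y hy
      simp only [hfg x hx, hfg y hy]
      exact hb hx hy
    have hle : ‖fderiv ℝ f (g u) (deriv g u)‖ ≤ 1 := by
      have := norm_deriv_le_of_lipschitzOn hnhds hlip
      rw [hcomp.deriv] at this
      simpa using this
    have h2 := (minNorm_mul_le (fderiv ℝ f (g u)) (deriv g u)).trans hle
    unfold dens
    gcongr
    rw [← ENNReal.ofReal_inv_of_pos hl, ← ofReal_norm]
    apply ENNReal.ofReal_le_ofReal
    rw [← one_div, le_div_iff₀ hl]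
    linarith
  have hgc := comp_clamp_cont hc hcont
  have hbc := comp_clamp_cont hc hb.continuousOn
  have hDm : Measurable fun u => dens f ρ (g (clamp c u)) := (dens_meas hn f hρ).comp hgc.measurable
  have hRm : Measurable fun u => R (b (clamp c u)) := hR.comp hbc.measurable
  have hin : ∀ t ∈ Ico 0 h, ∀ j < m, t + j * h ∈ Icc 0 c ∧ t + j * h < c := by
    intro t ht j hj
    have hj' : (j:ℝ) + 1 ≤ m := by exact_mod_cast hj
    have : t + j * h < c := by rw [← hmh]; nlinarith [ht.2]
    exact ⟨⟨by have := ht.1; positivity, this.le⟩, this⟩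
  have hbp : ∀ t ∈ Ico 0 h, ∀ j < m, b (t + j * h) = b t := by
    intro t ht j hj
    rcases Nat.eq_zero_or_pos j with rfl | hj0
    · simp
    · exact (hw t j ht.1 hj0 (by omega) (hin t ht j hj).2).1
  have hgd : ∀ t ∈ Ico 0 h, ∀ j < m, ∀ k < m, j < k → g (t + k * h) ≠ g (t + j * h) := by
    intro t ht j hj k hk hjk
    have e : t + k * h = (t + j * h) + ((k - j : ℕ) : ℝ) * h := by
      rw [Nat.cast_sub hjk.le]; ring
    rw [e]
    exact (hw _ (k - j) (hin t ht j hj).1.1 (by omega) (by omega) (by rw [← e]; exact (hin t ht k hk).2)).2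
  -- a.e. goodness for all translates
  have hgood' : ∀ᵐ t, ∀ j : ℕ, (t + j * h) ∈ Icc 0 c → g (t + j * h) ∈ good f D := by
    rw [ae_all_iff]
    intro j
    exact (measurePreserving_add_right (volume : Measure ℝ) (j * h)).quasiMeasurePreserving.ae hgood
  calc _ ≤ ∫⁻ u in Ico 0 c, dens f ρ (g (clamp c u)) := s1
    _ = ∑ j ∈ Finset.range m, ∫⁻ t in Ico 0 h, dens f ρ (g (clamp c (t + j * h))) := by
        conv_lhs => rw [← hmh]
        rw [lintegral_Ico_split _ hh0, hmh]
    _ = ∫⁻ t in Ico 0 h, ∑ j ∈ Finset.range m, dens f ρ (g (clamp c (t + j * h))) := by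
        rw [lintegral_finsetSum]
        intro j _
        exact hDm.comp (measurable_id.add_const _)
    _ ≤ ∫⁻ t in Ico 0 h, ∑ j ∈ Finset.range m, R (b (clamp c (t + j * h))) := by
        refine setLIntegral_mono_ae' measurableSet_Ico ?_
        filter_upwards [hgood'] with t ht ht'
        have e1 : ∑ j ∈ Finset.range m, dens f ρ (g (clamp c (t + j * h))) =
            ∑ j ∈ Finset.range m, dens f ρ (g (t + j * h)) :=
          Finset.sum_congr rfl fun j hj => by
            rw [clamp_eq (hin t ht' j (Finset.mem_range.1 hj)).1]
        have e2 : ∑ j ∈ Finset.range m, R (b (clamp c (t + j * h))) = m * R (b t) := by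
          rw [Finset.sum_congr rfl fun j hj => by
            rw [clamp_eq (hin t ht' j (Finset.mem_range.1 hj)).1,
              hbp t ht' j (Finset.mem_range.1 hj)]]
          simp
        rw [e1, e2]
        have hinj : Set.InjOn (fun j : ℕ => g (t + j * h)) (Finset.range m) := by
          intro j hj k hk hjk
          have hj := Finset.mem_range.1 hj
          have hk := Finset.mem_range.1 hk
          rcases lt_trichotomy j k with hlt | heq | hlt
          · exact absurd hjk.symm (hgd t ht' j hj k hk hlt)
          · exact heq
          · exact absurd hjk (hgd t ht' k hk j hj hlt)
        classical
        rw [← Finset.sum_image (f := dens f ρ) hinj]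
        refine hRs _ _ (Finset.card_image_le.trans (by simp)) ?_
        intro x hx
        obtain ⟨j, hj, rfl⟩ := Finset.mem_image.1 hx
        have hj := Finset.mem_range.1 hj
        exact ⟨ht j (hin t ht' j hj).1, by rw [hfg _ (hin t ht' j hj).1, hbp t ht' j hj]⟩
    _ = ∑ j ∈ Finset.range m, ∫⁻ t in Ico 0 h, R (b (clamp c (t + j * h))) := by
        rw [lintegral_finsetSum]
        intro j _
        exact hRm.comp (measurable_id.add_const _)
    _ = ∫⁻ u in Ico 0 c, R (b (clamp c u)) := by
        conv_rhs => rw [← hmh]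
        rw [lintegral_Ico_split _ hh0, hmh]
    _ = ∫⁻ u in Ico 0 c, R (b u) := by
        refine setLIntegral_congr_fun measurableSet_Ico fun u hu => ?_
        rw [clamp_eq (Ico_subset_Icc_self hu)]
    _ ≤ _ := lintegral_mono_set Ico_subset_Icc_self

theorem mainIneq
    {n : ℕ} (hn : 2 ≤ n) (D : Set (Eu n))
    (hDopen : IsOpen D) (f : Eu n → Eu n)
    (hf : ContinuousOn f D)
    (hdiff : ∀ᵐ x ∂(volume.restrict D), DifferentiableAt ℝ f x)
    (hN : NProp f D) (hNinv : NInvProp f D)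
    (p : ℝ) (hp : 1 ≤ p) (hACP : ACPinv p f D)
    (Γ : Set (Curve n)) (hΓ : ∀ γ ∈ Γ, γ.InSet D)
    (m : ℕ) (hm : 0 < m) (hwind : ∀ γ ∈ Γ, Winds f m γ)
    (ρ : Eu n → ℝ≥0∞) (hρ : Admissible ρ Γ) :
    modulus p (pushforward f Γ) ≤
      (m : ℝ≥0∞)⁻¹ * ∫⁻ x in D, KIp p f x * ρ x ^ p := by
  have hp0 : 0 < p := by linarith
  obtain ⟨R, hR, hRint, hRs⟩ := exists_density hn hDopen hf hp hm hρ.1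
  set F := toMeasurable volume (f '' (D \ good f D)) with hF
  have hFm : MeasurableSet F := measurableSet_toMeasurable _ _
  have hF0 : volume F = 0 := by
    rw [hF, measure_toMeasurable]; exact good_image_null hdiff hDopen hN hNinv
  refine le_trans ?_ hRint
  refine ENNReal.le_of_forall_pos_le_add fun η hη _ => ?_
  have hη' : (0 : ℝ≥0∞) < η := by exact_mod_cast hη
  unfold ACPinv at hACP
  set Γ₀ := {β : Curve n | β.InSet (f '' D) ∧
    ¬ ∀ γ : Curve n, γ.a = β.a → γ.b = β.b → γ.InSet D →
        (∀ t ∈ Set.Icc γ.a γ.b, f (γ.toFun t) = β.toFun t) →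
        γ.Rectifiable ∧ ∃ αs : ℝ → EuclideanSpace ℝ (Fin n),
          (∀ t ∈ Set.Icc γ.a γ.b, γ.toFun t = αs (β.lengthFun t)) ∧
          AbsContOn αs 0 β.length} with hΓ₀
  obtain ⟨ρ₀, hρ₀, hρ₀i⟩ : ∃ ρ₀, Admissible ρ₀ Γ₀ ∧ ∫⁻ x, ρ₀ x ^ p < η := by
    rw [← hACP] at hη'
    unfold modulus at hη'
    obtain ⟨ρ₀, h1⟩ := iInf_lt_iff.1 hη'
    obtain ⟨h2, h3⟩ := iInf_lt_iff.1 h1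
    exact ⟨ρ₀, h2, h3⟩
  set χ : Eu n → ℝ≥0∞ := F.indicator fun _ => ⊤ with hχ
  have hχm : Measurable χ := measurable_const.indicator hFm
  set σ : Eu n → ℝ≥0∞ := fun x => max (R x) (max (ρ₀ x) (χ x)) with hσ
  have hσm : Measurable σ := hR.max (hρ₀.1.max hχm)
  have hσint : ∫⁻ x, σ x ^ p ≤ (∫⁻ y, R y ^ p) + η := by
    calc ∫⁻ x, σ x ^ p ≤ ∫⁻ x, (R x ^ p + ρ₀ x ^ p) := by
          apply lintegral_mono_ae
          have : ∀ᵐ x, x ∉ F := measure_eq_zero_iff_ae_notMem.1 hF0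
          filter_upwards [this] with x hx
          have : χ x = 0 := indicator_of_notMem hx _
          simp only [hσ, this]
          rcases le_total (R x) (ρ₀ x) with h | h <;> simp [h]
      _ = (∫⁻ x, R x ^ p) + ∫⁻ x, ρ₀ x ^ p := lintegral_add_left (hR.pow_const p) _
      _ ≤ _ := by gcongr
  refine le_trans (iInf₂_le σ ⟨hσm, ?_⟩) hσint
  have hmono : ∀ (τ : Eu n → ℝ≥0∞) (β : Curve n), (∀ x, τ x ≤ σ x) → 1 ≤ lineIntegral τ β →
      1 ≤ lineIntegral σ β := fun τ β h h1 => h1.trans (lintegral_mono fun t => h _)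
  rintro β ⟨α, hα, hab, hbb, hβα⟩ hβ
  by_cases hβ0 : β ∈ Γ₀
  · exact hmono ρ₀ β (fun x => (le_max_left _ _).trans (le_max_right _ _)) (hρ₀.2 β hβ0 hβ)
  have hαD := hΓ α hα
  have hβD : β.InSet (f '' D) := by
    intro t ht
    rw [hab, hbb] at ht
    rw [hβα t ht]
    exact mem_image_of_mem f (hαD t ht)
  have hlift : ∀ γ : Curve n, γ.a = β.a → γ.b = β.b → γ.InSet D →
        (∀ t ∈ Set.Icc γ.a γ.b, f (γ.toFun t) = β.toFun t) →
        γ.Rectifiable ∧ ∃ αs : ℝ → EuclideanSpace ℝ (Fin n),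
          (∀ t ∈ Set.Icc γ.a γ.b, γ.toFun t = αs (β.lengthFun t)) ∧
          AbsContOn αs 0 β.length := by
    by_contra hcon
    exact hβ0 ⟨hβD, hcon⟩
  obtain ⟨hαr, g, hg, hgac⟩ := hlift α hab.symm hbb.symm hαD fun t ht => (hβα t ht).symm
  have hc := length_nonneg β
  set c := β.length with hcdef
  have hac := ac_of hc hgac
  have hcont : ContinuousOn g (Icc 0 c) := by
    have := hac.continuousOn
    rwa [uIcc_of_le hc] at this
  have hlip := normalRep_lip hβ
  have hgf : ∀ u ∈ Icc 0 c, g u ∈ D ∧ f (g u) = β.normalRep u := by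
    intro u hu
    obtain ⟨t, ht, rfl⟩ := lengthFun_surj hβ hu
    rw [normalRep_lengthFun hβ ht]
    rw [hab, hbb] at ht
    rw [← hg t ht, hβα t ht]
    exact ⟨hαD t ht, rfl⟩
  by_cases hbad : ∀ᵐ u, u ∈ Icc 0 c → β.normalRep u ∉ F
  swap
  · refine hmono χ β (fun x => (le_max_right _ _).trans (le_max_right _ _)) ?_
    unfold lineIntegral
    have hbc := comp_clamp_cont hc hlip.continuousOn
    set E := Icc 0 c ∩ (fun u => β.normalRep (clamp c u)) ⁻¹' F with hE
    have hEm : MeasurableSet E := measurableSet_Icc.inter (hbc.measurable hFm)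
    have hE0 : volume E ≠ 0 := by
      intro h0
      apply hbad
      filter_upwards [measure_eq_zero_iff_ae_notMem.1 h0] with u hu hu1 hu2
      exact hu ⟨hu1, by simpa [clamp_eq hu1] using hu2⟩
    calc (1:ℝ≥0∞) ≤ ⊤ := le_top
      _ = ∫⁻ u in E, ⊤ := by rw [setLIntegral_const, ENNReal.top_mul hE0]
      _ = ∫⁻ u in E, χ (β.normalRep u) := by
          refine setLIntegral_congr_fun hEm fun u hu => ?_
          have h2 : β.normalRep u ∈ F := by
            have := hu.2
            simpa [clamp_eq hu.1] using this
          simp only [hχ]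
          rw [indicator_of_mem h2]
      _ ≤ _ := lintegral_mono_set inter_subset_left
  have hgood : ∀ᵐ u, u ∈ Icc 0 c → g u ∈ good f D := by
    filter_upwards [hbad] with u hu huc
    by_contra hcon
    obtain ⟨h1, h2⟩ := hgf u huc
    exact hu huc (subset_toMeasurable _ _ ⟨g u, ⟨h1, hcon⟩, h2⟩)
  refine hmono R β (fun x => le_max_left _ _) ?_
  refine (hρ.2 α hα hαr).trans ?_
  rw [lineIntegral_reparam hab hbb hβ hαr hg hcont ρ]
  refine (lineIntegral_le hc hcont hac hρ.1).trans ?_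
  refine key hn hm hρ.1 hR hRs hc hcont hac (fun u hu => (hgf u hu).2) hlip hgood ?_
  obtain ⟨β', ha', hb', hβ'α, hβ', g', hg', hw⟩ := hwind α hα
  have q1 : β'.a = β.a := ha'.trans hab.symm
  have q2 : β'.b = β.b := hb'.trans hbb.symm
  have q3 : ∀ t ∈ Icc β.a β.b, β'.toFun t = β.toFun t := by
    intro t ht
    rw [hab, hbb] at ht
    rw [hβ'α t ht, hβα t ht]
  obtain ⟨-, e2, e3⟩ := eqv q1 q2 q3
  have e4 := normalRep_eqv q1 q2 q3 hβ
  have e5 : ∀ u ∈ Icc 0 c, g' u = g u := by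
    intro u hu
    obtain ⟨t, ht, rfl⟩ := lengthFun_surj hβ hu
    have ht' := ht
    rw [hab, hbb] at ht'
    rw [← hg t ht', ← e3 t ht, ← hg' t ht']
  intro t j ht h1 h2 h3
  have h4 : 0 ≤ (j : ℝ) * (c / m) := by positivity
  have m1 : t ∈ Icc 0 c := ⟨ht, by linarith⟩
  have m2 : t + j * (c / m) ∈ Icc 0 c := ⟨by linarith, h3.le⟩
  have := hw t j ht h1 h2 (by rw [e2]; exact h3)
  rw [e2] at this
  rwa [e4 _ m1, e4 _ m2, e5 _ m1, e5 _ m2] at this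

end VTM


/-- **Theorem 2 (main result).** Let `p ≥ 1`, let `D ⊂ ℝⁿ` (`n ≥ 2`) be a domain and let
`f : D → ℝⁿ` be a continuous, discrete mapping, differentiable a.e. in `D`, having the `N`,
`N⁻¹` and `ACP_p⁻¹` properties. If `Γ` is a curve family in `D`, `m` is a positive integer and
`f` winds every curve of `Γ` `m` times around itself, then for every `ρ` admissible for `Γ`,
`M_p(f(Γ)) ≤ (1/m) ∫_D K_{I,p}(x, f) ρ(x)^p dm(x)`. -/
theorem vaisala_type_modulus_inequality
    {n : ℕ} (hn : 2 ≤ n) (D : Set (EuclideanSpace ℝ (Fin n)))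
    (hDopen : IsOpen D) (hDconn : IsConnected D)
    (f : EuclideanSpace ℝ (Fin n) → EuclideanSpace ℝ (Fin n))
    (hf : ContinuousOn f D)
    (hdiff : ∀ᵐ x ∂(volume.restrict D), DifferentiableAt ℝ f x)
    (hdisc : DiscreteMap f D)
    (hN : NProp f D) (hNinv : NInvProp f D)
    (p : ℝ) (hp : 1 ≤ p) (hACP : ACPinv p f D)
    (Γ : Set (Curve n)) (hΓ : ∀ γ ∈ Γ, γ.InSet D)
    (m : ℕ) (hm : 0 < m) (hwind : ∀ γ ∈ Γ, Winds f m γ)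
    (ρ : EuclideanSpace ℝ (Fin n) → ℝ≥0∞) (hρ : Admissible ρ Γ) :
    modulus p (pushforward f Γ) ≤
      (m : ℝ≥0∞)⁻¹ * ∫⁻ x in D, KIp p f x * ρ x ^ p := by
  exact VTM.mainIneq hn D hDopen f hf hdiff hN hNinv p hp hACP Γ hΓ m hm hwind ρ hρ
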